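/- Let V be a nonempty set such that the true lacuna L = L(V) = {Q ∈ W_E : (10Q) ∩ E = (90Q) ∩ E = V} is nonempty. Let Q ∈ L and suppose there exists a Whitney cube K ∈ W_E with K ∉ L and K ∩ Q ≠ ∅. Then there is an absolute constant C ≥ 1 such that either C^{-1}·diam V ≤ diam Q ≤ C·diam V, or C^{-1}·dist(V, E∖V) ≤ diam Q ≤ C·dist(V, E∖V). -/

import Mathlib

open scoped ENNReal

noncomputable section

/-- The cube `Q(c,r)` in `ℝⁿ` with the uniform norm: the closed ball of center `c = Q.1` and
radius `r = Q.2`.  A cube is encoded by the pair `Q = (c, r)`. -/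
def cube {n : ℕ} (Q : (Fin n → ℝ) × ℝ) : Set (Fin n → ℝ) :=
  Metric.closedBall Q.1 Q.2

/-- The dilation `λQ = Q(c, λr)` of the cube `Q = (c, r)`. -/
def dilate {n : ℕ} (l : ℝ) (Q : (Fin n → ℝ) × ℝ) : Set (Fin n → ℝ) :=
  Metric.closedBall Q.1 (l * Q.2)

/-- Extended distance between two sets: `dist(A, B) = inf {‖a - b‖ : a ∈ A, b ∈ B}`, with the
convention that it equals `+∞` if one of the sets is empty. -/
def eSetDist {n : ℕ} (A B : Set (Fin n → ℝ)) : ℝ≥0∞ :=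
  ⨅ a ∈ A, ⨅ b ∈ B, edist a b

/-- `W` is a Whitney covering of `ℝⁿ ∖ E`: a countable family of pairwise non-overlapping
cubes whose union is `ℝⁿ ∖ E` and such that `diam Q ≤ dist(Q, E) ≤ 4 diam Q` for all
`Q ∈ W`. -/
structure IsWhitney {n : ℕ} (E : Set (Fin n → ℝ)) (W : Set ((Fin n → ℝ) × ℝ)) : Prop where
  countable : W.Countable
  radius_pos : ∀ Q ∈ W, 0 < Q.2
  nonoverlap : ∀ Q ∈ W, ∀ Q' ∈ W, Q ≠ Q' →
    Disjoint (interior (cube Q)) (interior (cube Q'))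
  union_eq : (⋃ Q ∈ W, cube Q) = Eᶜ
  diam_le_dist : ∀ Q ∈ W, EMetric.diam (cube Q) ≤ eSetDist (cube Q) E
  dist_le_diam : ∀ Q ∈ W, eSetDist (cube Q) E ≤ 4 * EMetric.diam (cube Q)

/-- The true lacuna associated with a set `V`:
`L(V) = {Q ∈ W : (10Q) ∩ E = (90Q) ∩ E = V}`. -/
def lacuna {n : ℕ} (E : Set (Fin n → ℝ)) (W : Set ((Fin n → ℝ) × ℝ))
    (V : Set (Fin n → ℝ)) : Set ((Fin n → ℝ) × ℝ) :=
  {Q ∈ W | dilate 10 Q ∩ E = V ∧ dilate 90 Q ∩ E = V}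

section WhitneyCubes

variable {n : ℕ} {E : Set (Fin n → ℝ)} {W : Set ((Fin n → ℝ) × ℝ)}

lemma center_mem_cube {Q : (Fin n → ℝ) × ℝ} (hQ : 0 ≤ Q.2) : Q.1 ∈ cube Q :=
  Metric.mem_closedBall_self hQ

lemma eSetDist_le_edist {A B : Set (Fin n → ℝ)} {a b : Fin n → ℝ} (ha : a ∈ A) (hb : b ∈ B) :
    eSetDist A B ≤ edist a b :=
  iInf₂_le_of_le a ha (iInf₂_le b hb)

lemma ediam_cube [NeZero n] {Q : (Fin n → ℝ) × ℝ} (hQ : 0 ≤ Q.2) :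
    Metric.ediam (cube Q) = ENNReal.ofReal (2 * Q.2) := by
  rw [← Metric.diam_closedBall_eq Q.1 hQ]
  exact (ENNReal.ofReal_toReal Metric.isBounded_closedBall.ediam_ne_top).symm

namespace IsWhitney

lemma neZero (hW : IsWhitney E W) (hE : E.Nonempty) {Q : (Fin n → ℝ) × ℝ} (hQ : Q ∈ W) :
    NeZero n := by
  refine ⟨?_⟩
  rintro rfl
  obtain ⟨e, he⟩ := hE
  have hc : Q.1 ∈ Eᶜ := by
    rw [← hW.union_eq]
    exact Set.mem_biUnion hQ (center_mem_cube (hW.radius_pos Q hQ).le)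
  exact hc (Subsingleton.elim e Q.1 ▸ he)

lemma two_mul_radius_le_dist [NeZero n] (hW : IsWhitney E W) {Q : (Fin n → ℝ) × ℝ} (hQ : Q ∈ W)
    {p e : Fin n → ℝ} (hp : p ∈ cube Q) (he : e ∈ E) : 2 * Q.2 ≤ dist p e := by
  have h := (hW.diam_le_dist Q hQ).trans (eSetDist_le_edist hp he)
  change Metric.ediam _ ≤ _ at h
  rwa [ediam_cube (hW.radius_pos Q hQ).le, edist_dist,
    ENNReal.ofReal_le_ofReal_iff dist_nonneg] at h

lemma exists_dist_center_lt [NeZero n] (hW : IsWhitney E W) {Q : (Fin n → ℝ) × ℝ} (hQ : Q ∈ W) :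
    ∃ e ∈ E, dist Q.1 e < 19 / 2 * Q.2 := by
  have hr := hW.radius_pos Q hQ
  have h : eSetDist (cube Q) E < ENNReal.ofReal (17 / 2 * Q.2) := by
    refine (hW.dist_le_diam Q hQ).trans_lt ?_
    change 4 * Metric.ediam _ < _
    rw [ediam_cube hr.le, ← ENNReal.ofReal_ofNat 4, ← ENNReal.ofReal_mul (by norm_num),
      ENNReal.ofReal_lt_ofReal_iff (by positivity)]
    linarith
  simp only [eSetDist, iInf_lt_iff] at h
  obtain ⟨a, ha, e, he, hae⟩ := h
  rw [edist_dist, ENNReal.ofReal_lt_ofReal_iff (by positivity)] at hae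
  refine ⟨e, he, ?_⟩
  have := dist_triangle_left Q.1 e a
  linarith [Metric.mem_closedBall.1 ha]

lemma radius_le_of_inter_nonempty [NeZero n] (hW : IsWhitney E W) {K Q : (Fin n → ℝ) × ℝ}
    (hK : K ∈ W) (hQ : Q ∈ W) (h : (cube K ∩ cube Q).Nonempty) : Q.2 ≤ 21 / 4 * K.2 := by
  obtain ⟨p, hpK, hpQ⟩ := h
  obtain ⟨e, he, hKe⟩ := hW.exists_dist_center_lt hK
  have := hW.two_mul_radius_le_dist hQ hpQ he
  have := dist_triangle p K.1 e
  linarith [Metric.mem_closedBall.1 hpK]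

end IsWhitney

/-- If a point of `E ∖ V` lies at distance at most `500 r` from the center of a cube of radius `r`
in the lacuna of `V`, then `dist(V, E ∖ V)` is comparable to the diameter of that cube. -/
lemma eSetDist_comparable_of_mem_lacuna [NeZero n] {V : Set (Fin n → ℝ)} (hV : V.Nonempty)
    {Q : (Fin n → ℝ) × ℝ} (hr : 0 < Q.2) (hQ : Q ∈ lacuna E W V) {e : Fin n → ℝ} (he : e ∈ E \ V)
    (hQe : dist Q.1 e ≤ 500 * Q.2) :
    eSetDist V (E \ V) / 1000 ≤ Metric.ediam (cube Q) ∧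
      Metric.ediam (cube Q) ≤ 1000 * eSetDist V (E \ V) := by
  obtain ⟨-, h10, h90⟩ := hQ
  have hV10 : ∀ v ∈ V, dist v Q.1 ≤ 10 * Q.2 := fun v hv => (h10.symm ▸ hv).1
  rw [ediam_cube hr.le]
  constructor
  · obtain ⟨v, hv⟩ := hV
    refine ENNReal.div_le_of_le_mul ((eSetDist_le_edist hv he).trans ?_)
    rw [edist_dist, ← ENNReal.ofReal_ofNat 1000, ← ENNReal.ofReal_mul (by positivity)]
    refine ENNReal.ofReal_le_ofReal ?_
    linarith [dist_triangle v Q.1 e, hV10 v hv]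
  · have : ENNReal.ofReal (2 * Q.2) ≤ eSetDist V (E \ V) := by
      refine le_iInf₂ fun v hv => le_iInf₂ fun x hx => ?_
      rw [edist_dist]
      refine ENNReal.ofReal_le_ofReal ?_
      have hx90 : 90 * Q.2 < dist x Q.1 := by
        by_contra! h
        exact hx.2 (h90 ▸ ⟨h, hx.1⟩)
      linarith [dist_triangle_left x Q.1 v, hV10 v hv]
    exact this.trans (le_mul_of_one_le_left' (by norm_num))

/-- If `V` contains two points at distance at least `r / 100`, then the diameter of `V` is
comparable to that of any cube of radius `r` in the lacuna of `V`. -/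
lemma ediam_comparable_of_mem_lacuna [NeZero n] {V : Set (Fin n → ℝ)}
    {Q : (Fin n → ℝ) × ℝ} (hr : 0 < Q.2) (hQ : Q ∈ lacuna E W V) {v w : Fin n → ℝ}
    (hv : v ∈ V) (hw : w ∈ V) (hvw : Q.2 ≤ 100 * dist v w) :
    Metric.ediam V / 1000 ≤ Metric.ediam (cube Q) ∧
      Metric.ediam (cube Q) ≤ 1000 * Metric.ediam V := by
  obtain ⟨-, h10, -⟩ := hQ
  have hV10 : ∀ v ∈ V, dist v Q.1 ≤ 10 * Q.2 := fun v hv => (h10.symm ▸ hv).1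
  rw [ediam_cube hr.le]
  constructor
  · refine ENNReal.div_le_of_le_mul (Metric.ediam_le fun x hx y hy => ?_)
    rw [edist_dist, ← ENNReal.ofReal_ofNat 1000, ← ENNReal.ofReal_mul (by positivity)]
    refine ENNReal.ofReal_le_ofReal ?_
    linarith [dist_triangle_right x y Q.1, hV10 x hx, hV10 y hy]
  · refine le_trans ?_ (mul_le_mul_right (Metric.edist_le_ediam_of_mem hv hw) _)
    rw [edist_dist, ← ENNReal.ofReal_ofNat 1000, ← ENNReal.ofReal_mul (by positivity)]
    refine ENNReal.ofReal_le_ofReal ?_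
    linarith [dist_nonneg (x := v) (y := w)]

end WhitneyCubes

/-- Let `L = L(V)` be a nonempty true lacuna of a nonempty set `V`, let `Q ∈ L`, and suppose
some Whitney cube `K ∉ L` meets `Q`.  Then, for an absolute constant `C ≥ 1`, either
`C⁻¹·diam V ≤ diam Q ≤ C·diam V` or `C⁻¹·dist(V, E∖V) ≤ diam Q ≤ C·dist(V, E∖V)`. -/
theorem stmt7 :
    ∃ C : ℝ≥0∞, 1 ≤ C ∧ C ≠ ⊤ ∧
      ∀ (n : ℕ) (E : Set (Fin n → ℝ)) (W : Set ((Fin n → ℝ) × ℝ)),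
        E.Nonempty → IsClosed E → IsWhitney E W →
        ∀ V : Set (Fin n → ℝ), V.Nonempty →
        ∀ Q ∈ lacuna E W V,
        (∃ K ∈ W, K ∉ lacuna E W V ∧ (cube K ∩ cube Q).Nonempty) →
          (EMetric.diam V / C ≤ EMetric.diam (cube Q) ∧
            EMetric.diam (cube Q) ≤ C * EMetric.diam V) ∨
          (eSetDist V (E \ V) / C ≤ EMetric.diam (cube Q) ∧
            EMetric.diam (cube Q) ≤ C * eSetDist V (E \ V)) := by
  refine ⟨1000, by norm_num, by norm_num, ?_⟩
  rintro n E W hE - hW V hV Q hQ ⟨K, hK, hKL, hKQ⟩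
  have := hW.neZero hE hQ.1
  have hr := hW.radius_pos Q hQ.1
  have hs := hW.radius_pos K hK
  have hrs := hW.radius_le_of_inter_nonempty hK hQ.1 hKQ
  have hsr := hW.radius_le_of_inter_nonempty hQ.1 hK (Set.inter_comm _ _ ▸ hKQ)
  have h10_90 : dilate 10 K ∩ E ⊆ dilate 90 K ∩ E :=
    Set.inter_subset_inter_left _ (Metric.closedBall_subset_closedBall (by linarith))
  by_cases hsub : dilate 90 K ∩ E ⊆ V
  · left
    have hV10 : ¬V ⊆ dilate 10 K ∩ E := fun h =>
      hKL ⟨hK, (h10_90.trans hsub).antisymm h, hsub.antisymm (h.trans h10_90)⟩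
    obtain ⟨v, hv, hvK⟩ := Set.not_subset.1 hV10
    have hvE : v ∈ E := (hQ.2.1.symm ▸ hv : v ∈ dilate 10 Q ∩ E).2
    have hvK' : 10 * K.2 < dist v K.1 := by
      by_contra! h
      exact hvK ⟨h, hvE⟩
    obtain ⟨e, he, hKe⟩ := hW.exists_dist_center_lt hK
    have heV : e ∈ V := hsub <| h10_90
      ⟨Metric.mem_closedBall'.2 (by linarith), he⟩
    refine ediam_comparable_of_mem_lacuna hr hQ hv heV ?_
    linarith [dist_triangle_right v K.1 e]
  · right
    obtain ⟨e, ⟨heK, heE⟩, heV⟩ := Set.not_subset.1 hsub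
    refine eSetDist_comparable_of_mem_lacuna hV hr hQ ⟨heE, heV⟩ ?_
    obtain ⟨p, hpK, hpQ⟩ := hKQ
    have := dist_triangle4 Q.1 p K.1 e
    linarith [Metric.mem_closedBall'.1 heK, Metric.mem_closedBall'.1 hpQ,
      Metric.mem_closedBall.1 hpK]
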